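/- Let n be a positive integer, η_{n+1} = (√((n+1)²+4) − (n+1))/2, and let σ > 0 satisfy σ < n + η_{n+1}. Suppose r is an irrational number with 0 < r ≤ 1/(n+1), B_σ(r) < +∞, and B_σ(r) ≤ B_σ(x) for every irrational x ∈ (0,1). Then r ≤ η_{n+1}. -/

import Mathlib

open Real Set MeasureTheory
open scoped ENNReal

/-- The Gauss map `A(x) = 1/x - ⌊1/x⌋`. -/
noncomputable def gaussMap (x : ℝ) : ℝ := 1 / x - (⌊1 / x⌋ : ℝ)

/-- `brjunoBeta x j = β_{j-1}(x) = ∏_{i=0}^{j-1} A^i(x)`; in particular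
`brjunoBeta x 0 = β_{-1}(x) = 1` and `β_K(x) = brjunoBeta x (K+1)`. -/
noncomputable def brjunoBeta (x : ℝ) (j : ℕ) : ℝ := ∏ i ∈ Finset.range j, gaussMap^[i] x

/-- The σ-Brjuno function `B_σ(x) = Σ_{j≥0} β_{j-1}(x) · (A^j x)^{-1/σ}`, valued in `[0,+∞]`. -/
noncomputable def brjuno (σ x : ℝ) : ℝ≥0∞ :=
  ∑' j : ℕ, ENNReal.ofReal (brjunoBeta x j * (gaussMap^[j] x) ^ (-(1 / σ)))

/-- The K-th partial sum `B_σ^{(K)}(x) = Σ_{j=0}^{K} β_{j-1}(x) · (A^j x)^{-1/σ}`. -/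
noncomputable def brjunoPartial (σ x : ℝ) (K : ℕ) : ℝ :=
  ∑ j ∈ Finset.range (K + 1), brjunoBeta x j * (gaussMap^[j] x) ^ (-(1 / σ))

/-- The fixed point `η_m = (√(m²+4) − m)/2 = [0; m, m, m, ...]` of the Gauss map. -/
noncomputable def eta (m : ℕ) : ℝ := (Real.sqrt ((m : ℝ) ^ 2 + 4) - m) / 2

/-- `b* = (σ+1)^{1+1/σ}/σ`. -/
noncomputable def bstar (σ : ℝ) : ℝ := (σ + 1) ^ (1 + 1 / σ) / σ

/-- The global lower bound `g(x) = x^{-1/σ} + b*·x`. -/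
noncomputable def gLow (σ x : ℝ) : ℝ := x ^ (-(1 / σ)) + bstar σ * x

/-- The cylinder lower bound `g_k(x) = x^{-1/σ} + x·(1/x − k)^{-1/σ} + (1 − kx)·b*`. -/
noncomputable def gCyl (σ : ℝ) (k : ℕ) (x : ℝ) : ℝ :=
  x ^ (-(1 / σ)) + x * (1 / x - (k : ℝ)) ^ (-(1 / σ)) + (1 - (k : ℝ) * x) * bstar σ

/-- The functional equation `B_σ(x) = x^{-1/σ} + x · B_σ(A x)`. -/
theorem brjuno_eq_add_mul_brjuno_gaussMap (σ x : ℝ) (hx : 0 ≤ x) :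
    brjuno σ x = ENNReal.ofReal (x ^ (-(1 / σ))) +
      ENNReal.ofReal x * brjuno σ (gaussMap x) := by
  unfold brjuno
  rw [tsum_eq_zero_add' ENNReal.summable, ← ENNReal.tsum_mul_left]
  congr 1
  · simp [brjunoBeta]
  · refine tsum_congr fun j => ?_
    rw [← ENNReal.ofReal_mul hx, ← mul_assoc]
    simp only [brjunoBeta, Finset.prod_range_succ', Function.iterate_succ_apply,
      Function.iterate_zero, id_eq]
    rw [mul_comm x]

theorem irrational_gaussMap {x : ℝ} (hx : Irrational x) : Irrational (gaussMap x) := by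
  unfold gaussMap
  rw [one_div]
  exact hx.inv.sub_intCast _

theorem gaussMap_mem_Ioo {x : ℝ} (hx : Irrational x) : gaussMap x ∈ Set.Ioo (0 : ℝ) 1 :=
  ⟨lt_of_le_of_ne (Int.fract_nonneg (1 / x)) (irrational_gaussMap hx).ne_zero.symm,
    Int.fract_lt_one (1 / x)⟩

theorem eta_pos (m : ℕ) : 0 < eta m := by
  have h : (m : ℝ) < Real.sqrt ((m : ℝ) ^ 2 + 4) := Real.lt_sqrt_of_sq_lt (by linarith)
  unfold eta
  linarith

theorem eta_sq_add (m : ℕ) : eta m ^ 2 + m * eta m = 1 := by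
  have h := Real.sq_sqrt (show (0 : ℝ) ≤ (m : ℝ) ^ 2 + 4 by positivity)
  unfold eta
  nlinarith

theorem one_div_eta (m : ℕ) : 1 / eta m = m + eta m := by
  rw [div_eq_iff (eta_pos m).ne']
  linarith [eta_sq_add m]

theorem eta_lt_one {m : ℕ} (hm : 0 < m) : eta m < 1 := by
  have h1 : (1 : ℝ) ≤ m := by exact_mod_cast hm
  nlinarith [eta_pos m, eta_sq_add m]

theorem irrational_eta {m : ℕ} (hm : 2 ≤ m) : Irrational (eta m) := by
  have h : Irrational (Real.sqrt ((m : ℝ) ^ 2 + 4)) := by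
    have h' : ¬ IsSquare (m ^ 2 + 4) := by
      rintro ⟨k, hk⟩
      have h1 : m < k := by nlinarith
      have h2 : k < m + 2 := by nlinarith
      obtain rfl : k = m + 1 := by omega
      have h3 : 2 * m = 3 := by linarith
      omega
    have := irrational_sqrt_natCast_iff.mpr h'
    push_cast at this
    exact this
  unfold eta
  exact_mod_cast (h.sub_natCast m).div_natCast (m := 2) (by norm_num)

theorem gaussMap_of_natCast_mem {x : ℝ} {m : ℕ} (h1 : (m : ℝ) ≤ 1 / x) (h2 : 1 / x < m + 1) :
    gaussMap x = 1 / x - m := by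
  have : ⌊1 / x⌋ = (m : ℤ) := Int.floor_eq_iff.mpr ⟨by exact_mod_cast h1, by exact_mod_cast h2⟩
  rw [gaussMap, this]
  norm_cast

theorem gaussMap_eta {m : ℕ} (hm : 0 < m) : gaussMap (eta m) = eta m := by
  have h := one_div_eta m
  rw [gaussMap_of_natCast_mem (m := m), h]
  · ring
  · linarith [eta_pos m]
  · linarith [eta_lt_one hm]

theorem brjuno_eta (σ : ℝ) {m : ℕ} (hm : 0 < m) :
    brjuno σ (eta m) = ENNReal.ofReal (eta m ^ (-(1 / σ)) / (1 - eta m)) := by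
  have hfix (j : ℕ) : gaussMap^[j] (eta m) = eta m :=
    Function.IsFixedPt.iterate (gaussMap_eta hm) j
  have h0 := (eta_pos m).le
  have hs := hasSum_geometric_of_lt_one h0 (eta_lt_one hm)
  simp only [brjuno, brjunoBeta, hfix, Finset.prod_const, Finset.card_range]
  rw [← ENNReal.ofReal_tsum_of_nonneg (fun j => by positivity) (hs.mul_right _).summable,
    (hs.mul_right _).tsum_eq, inv_mul_eq_div]

/-- The function `t ↦ t^{1+a} + (t-m)^{-a}` strictly decreases up to any point `s` at which
its derivative is nonpositive. -/
theorem rpow_add_rpow_sub_lt {a m s t : ℝ} (ha : 0 < a) (hm : 0 ≤ m) (hmt : m < t) (hts : t < s)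
    (hs : (1 + a) * s ^ a ≤ a * (s - m) ^ (-a - 1)) :
    s ^ (1 + a) + (s - m) ^ (-a) < t ^ (1 + a) + (t - m) ^ (-a) := by
  have hd (u : ℝ) (hu : m < u) : HasDerivAt (fun u : ℝ => u ^ (1 + a) + (u - m) ^ (-a))
      ((1 + a) * u ^ a - a * (u - m) ^ (-a - 1)) u := by
    have h1 := Real.hasDerivAt_rpow_const (p := 1 + a) (Or.inl (hm.trans_lt hu).ne')
    have h2 := ((hasDerivAt_id u).sub_const m).rpow_const (p := -a) (Or.inl (sub_pos.mpr hu).ne')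
    refine (h1.add h2).congr_deriv ?_
    rw [add_sub_cancel_left]
    simp only [id]
    ring
  have hanti : StrictAntiOn (fun u : ℝ => u ^ (1 + a) + (u - m) ^ (-a)) (Set.Icc t s) := by
    refine strictAntiOn_of_deriv_neg (convex_Icc t s)
      (fun u hu => (hd u (hmt.trans_le hu.1)).continuousAt.continuousWithinAt) fun u hu => ?_
    rw [interior_Icc] at hu
    have hmu := hmt.trans hu.1
    rw [(hd u hmu).deriv]
    have h1 : u ^ a < s ^ a := Real.rpow_lt_rpow (by linarith) hu.2 ha
    have h2 : (s - m) ^ (-a - 1) ≤ (u - m) ^ (-a - 1) :=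
      Real.rpow_le_rpow_of_nonpos (by linarith) (by linarith [hu.2]) (by linarith)
    have h3 := mul_lt_mul_of_pos_left h1 (show 0 < 1 + a by linarith)
    have h4 := mul_le_mul_of_nonneg_left h2 ha.le
    linarith
  exact hanti (Set.left_mem_Icc.mpr hts.le) (Set.right_mem_Icc.mpr hts.le) hts

/-- A finite minimum value of `B_σ` attained at `x` bounds itself below through the second
iterate of the functional equation. -/
theorem le_toReal_brjuno_of_minimizer {σ x : ℝ} (hx : Irrational x) (hx0 : 0 < x)
    (hfin : brjuno σ x < ⊤)
    (hmin : ∀ z : ℝ, Irrational z → z ∈ Set.Ioo (0 : ℝ) 1 → brjuno σ x ≤ brjuno σ z) :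
    x ^ (-(1 / σ)) + x * (gaussMap x ^ (-(1 / σ)) + gaussMap x * (brjuno σ x).toReal)
      ≤ (brjuno σ x).toReal := by
  have hy := irrational_gaussMap hx
  have hy0 := (gaussMap_mem_Ioo hx).1.le
  have hb := ENNReal.toReal_nonneg (a := brjuno σ x)
  rw [← ENNReal.ofReal_le_ofReal_iff hb, ENNReal.ofReal_add (by positivity) (by positivity),
    ENNReal.ofReal_mul hx0.le, ENNReal.ofReal_add (by positivity) (by positivity),
    ENNReal.ofReal_mul hy0, ENNReal.ofReal_toReal hfin.ne]
  conv_rhs => rw [brjuno_eq_add_mul_brjuno_gaussMap σ x hx0.le,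
    brjuno_eq_add_mul_brjuno_gaussMap σ _ hy0]
  gcongr
  exact hmin _ (irrational_gaussMap hy) (gaussMap_mem_Ioo hy)

/-- under the hypotheses of Proposition `MT`, the minimizer satisfies
`r ≤ η_{n+1}`. -/
theorem brjuno_minimizer_le_eta (n : ℕ) (hn : 0 < n) (σ : ℝ) (hσ : 0 < σ)
    (hσn : σ < n + eta (n + 1)) (r : ℝ) (hr : Irrational r) (hr0 : 0 < r)
    (hr1 : r ≤ 1 / ((n : ℝ) + 1)) (hfin : brjuno σ r < ⊤)
    (hmin : ∀ x : ℝ, Irrational x → x ∈ Set.Ioo (0 : ℝ) 1 → brjuno σ r ≤ brjuno σ x) :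
    r ≤ eta (n + 1) := by
  by_contra! hlt
  have hη0 := eta_pos (n + 1)
  have hη1 := eta_lt_one n.succ_pos
  have hsq := eta_sq_add (n + 1)
  have hinv := one_div_eta (n + 1)
  have hupper := ENNReal.toReal_mono (by simp [brjuno_eta])
    (hmin _ (irrational_eta (by omega : 2 ≤ n + 1)) ⟨hη0, hη1⟩)
  have hlower := le_toReal_brjuno_of_minimizer hr hr0 hfin hmin
  rw [brjuno_eta σ n.succ_pos, ENNReal.toReal_ofReal (by
    have : 0 < 1 - eta (n + 1) := by linarith
    positivity)] at hupper
  have hmpos : (0 : ℝ) < ((n + 1 : ℕ) : ℝ) := by positivity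
  have hrt : 1 / r < ((n + 1 : ℕ) : ℝ) + eta (n + 1) := by
    rw [← hinv]
    exact one_div_lt_one_div_of_lt hη0 hlt
  have hmt : ((n + 1 : ℕ) : ℝ) ≤ 1 / r := by
    rw [le_one_div hmpos hr0]
    push_cast
    exact hr1
  have hg : gaussMap r = 1 / r - ((n + 1 : ℕ) : ℝ) :=
    gaussMap_of_natCast_mem hmt (by linarith)
  have hy := (gaussMap_mem_Ioo hr).1
  have hry : r * gaussMap r = 1 - ((n + 1 : ℕ) : ℝ) * r := by
    rw [hg]
    field_simp
  have hσn' : σ + 1 < 1 / eta (n + 1) := by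
    rw [hinv]
    push_cast
    linarith
  generalize (brjuno σ r).toReal = b at hupper hlower
  generalize eta (n + 1) = η at *
  generalize ((n + 1 : ℕ) : ℝ) = m at *
  have ha : 0 < 1 / σ := by positivity
  have haσ : 1 / σ * σ = 1 := by field_simp
  generalize 1 / σ = a at *
  have hinv_rpow (p : ℝ) {z : ℝ} (hz : 0 < z) : (1 / z) ^ p = z ^ (-p) := by
    rw [one_div, Real.inv_rpow hz.le, Real.rpow_neg hz.le]
  have hder : (1 + a) * (m + η) ^ a ≤ a * (m + η - m) ^ (-a - 1) := by
    rw [← hinv, hinv_rpow a hη0, hinv, add_sub_cancel_left, Real.rpow_sub_one hη0.ne']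
    have h1 : 1 + a ≤ a * (1 / η) := by nlinarith
    calc (1 + a) * η ^ (-a) ≤ a * (1 / η) * η ^ (-a) := by gcongr
      _ = a * (η ^ (-a) / η) := by ring
  have key := rpow_add_rpow_sub_lt ha hmpos.le (by linarith) hrt hder
  rw [← hg, hinv_rpow _ hr0, ← hinv, hinv_rpow _ hη0, hinv, add_sub_cancel_left,
    neg_add', neg_sub_comm, Real.rpow_sub_one hη0.ne', Real.rpow_sub_one hr0.ne'] at key
  have hleft : η ^ (-a) / η + η ^ (-a) = m * (η ^ (-a) / (1 - η)) := by
    have : 1 - η ≠ 0 := by linarith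
    field_simp
    linear_combination -hsq
  have hright : r ^ (-a) / r + gaussMap r ^ (-a) ≤ m * b := by
    rw [div_add' _ _ _ hr0.ne', div_le_iff₀ hr0]
    linear_combination hlower - b * hry
  have := mul_le_mul_of_nonneg_left hupper hmpos.le
  linarith
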